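/- Let (x_k) be the IR-ISTA iterates with weights θ_k := 1/∏_{t=0}^{k}(1 − η_t γ μ_f) and averaged iterates x̄_K := (Σ_{k=0}^{K−1} θ_k η_k x_{k+1})/(Σ_{k=0}^{K−1} θ_k η_k). Assume Ĉ_f̄ := inf_{x∈E} f̄(x) > −∞, sup_{K≥1} (Σ_{j=0}^{K−1} θ_j η_j)/θ_{K−1} < ∞, lim_{k→∞} (Σ_{j=0}^{k} η_j² θ_j)/(Σ_{j=0}^{k} η_j θ_j) = 0, and Σ_{j=0}^{∞} η_j θ_j = ∞. Then the averaged iterates converge to the unique optimal solution of the bilevel problem: lim_{K→∞} x̄_K = x*. -/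

import Mathlib

open scoped RealInnerProductSpace
open Metric Filter

noncomputable section

section Convexity

variable {E : Type*} [NormedAddCommGroup E] [InnerProductSpace ℝ E]

theorem norm_sq_convexCombination_sub (p u v : E) (t : ℝ) :
    ‖(1 - t) • p + t • u - v‖ ^ 2
      = (1 - t) * ‖p - v‖ ^ 2 + t * ‖u - v‖ ^ 2 - t * (1 - t) * ‖u - p‖ ^ 2 := by
  have hsplit : (1 - t) • p + t • u - v = (p - v) + t • (u - p) := by module
  have hu : u - v = (p - v) + (u - p) := by abel
  rw [hsplit, hu, norm_add_sq_real, norm_add_sq_real, norm_smul, inner_smul_right, mul_pow,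
    Real.norm_eq_abs, sq_abs]
  ring

theorem le_sub_of_forall_le_sub_one_sub_mul {a b c : ℝ}
    (hle : ∀ t : ℝ, 0 < t → t < 1 → a ≤ b - (1 - t) * c) : a ≤ b - c := by
  have hlim : Tendsto (fun t : ℝ => b - (1 - t) * c) (nhdsWithin 0 (Set.Ioi 0))
      (nhds (b - (1 - 0) * c)) :=
    ((by fun_prop : Continuous fun t : ℝ => b - (1 - t) * c).tendsto 0).mono_left
      nhdsWithin_le_nhds
  rw [sub_zero, one_mul] at hlim
  refine ge_of_tendsto hlim ?_
  filter_upwards [Ioo_mem_nhdsGT (zero_lt_one (α := ℝ))] with t ht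
  exact hle t ht.1 ht.2

/-- The proximal objective grows quadratically away from its minimizer. -/
theorem ConvexOn.prox_three_point {ω : E → ℝ} (hω : ConvexOn ℝ Set.univ ω) {c : ℝ} {p v : E}
    (hp : ∀ u, ω p + c * ‖p - v‖ ^ 2 ≤ ω u + c * ‖u - v‖ ^ 2) (u : E) :
    ω p + c * ‖p - v‖ ^ 2 + c * ‖u - p‖ ^ 2 ≤ ω u + c * ‖u - v‖ ^ 2 := by
  rw [← le_sub_iff_add_le]
  refine le_sub_of_forall_le_sub_one_sub_mul fun t ht0 ht1 => ?_
  have hmin := hp ((1 - t) • p + t • u)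
  have hconv := hω.2 (Set.mem_univ p) (Set.mem_univ u) (sub_nonneg.2 ht1.le) ht0.le
    (sub_add_cancel 1 t)
  rw [norm_sq_convexCombination_sub] at hmin
  simp only [smul_eq_mul] at hconv
  refine le_of_mul_le_mul_left ?_ ht0
  linarith

theorem StrongConvexOn.norm_sub_sq_le_of_le_midpoint {F : E → ℝ} {m C : ℝ}
    (hF : StrongConvexOn Set.univ m F) {p u : E}
    (hC : C ≤ F ((1 / 2 : ℝ) • p + (1 / 2 : ℝ) • u)) :
    m / 8 * ‖p - u‖ ^ 2 ≤ (F p + F u) / 2 - C := by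
  have hsc := hF.2 (Set.mem_univ p) (Set.mem_univ u) (by norm_num : (0 : ℝ) ≤ 1 / 2)
    (by norm_num : (0 : ℝ) ≤ 1 / 2) (by norm_num)
  simp only [smul_eq_mul] at hsc
  linarith

/-- A sequence asymptotically optimal for both levels of a convex bilevel problem with strongly
convex upper level converges to the solution. -/
theorem tendsto_of_asymptotically_bilevel_optimal [ProperSpace E] {F H : E → ℝ} {m C : ℝ}
    (hF : StrongConvexOn Set.univ m F) (hm : 0 < m) (hFcont : Continuous F)
    (hH : ConvexOn ℝ Set.univ H) (hHcont : Continuous H) {p : E}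
    (hpF : ∀ z, H z ≤ H p → F p ≤ F z) (hC : ∀ z, C ≤ F z) {u : ℕ → E} {a b : ℕ → ℝ}
    (ha : Tendsto a atTop (nhds 0)) (hb : Tendsto b atTop (nhds 0))
    (hFu : ∀ᶠ k in atTop, F (u k) ≤ F p + a k) (hHu : ∀ᶠ k in atTop, H (u k) ≤ H p + b k) :
    Tendsto u atTop (nhds p) := by
  have hbdd : ∀ᶠ k in atTop, u k ∈ closedBall p (√((F p + 1 / 2 - C) / (m / 8))) := by
    filter_upwards [hFu, ha.eventually_lt_const zero_lt_one] with k hk hak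
    have hgrowth := hF.norm_sub_sq_le_of_le_midpoint (p := u k) (u := p) (hC _)
    rw [mem_closedBall, dist_eq_norm]
    refine Real.le_sqrt_of_sq_le ?_
    rw [le_div_iff₀ (by positivity)]
    linarith
  refine (isCompact_closedBall p _).tendsto_nhds_of_unique_mapClusterPt hbdd fun z _ hz => ?_
  obtain ⟨U, hU, hlim⟩ := mapClusterPt_iff_ultrafilter.1 hz
  have hFz : F z ≤ F p + 0 :=
    le_of_tendsto_of_tendsto ((hFcont.tendsto z).comp hlim) ((ha.mono_left hU).const_add _)
      (hFu.filter_mono hU)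
  have hHz : H z ≤ H p + 0 :=
    le_of_tendsto_of_tendsto ((hHcont.tendsto z).comp hlim) ((hb.mono_left hU).const_add _)
      (hHu.filter_mono hU)
  have hmid : H ((1 / 2 : ℝ) • z + (1 / 2 : ℝ) • p) ≤ H p := by
    have hconv := hH.2 (Set.mem_univ z) (Set.mem_univ p) (by norm_num : (0 : ℝ) ≤ 1 / 2)
      (by norm_num : (0 : ℝ) ≤ 1 / 2) (by norm_num)
    simp only [smul_eq_mul] at hconv
    linarith
  have hgrowth := hF.norm_sub_sq_le_of_le_midpoint (hpF _ hmid)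
  have hsq : ‖z - p‖ ^ 2 ≤ 0 := nonpos_of_mul_nonpos_right (by linarith) (by positivity : 0 < m / 8)
  rw [← sub_eq_zero, ← norm_eq_zero]
  exact pow_eq_zero_iff two_ne_zero |>.1 (le_antisymm hsq (sq_nonneg _))

theorem ConvexOn.map_weighted_average_le {F : E → ℝ} (hF : ConvexOn ℝ Set.univ F) {ι : Type*}
    {s : Finset ι} {w : ι → ℝ} {p : ι → E} {A R : ℝ} (hw : ∀ i ∈ s, 0 ≤ w i)
    (hpos : 0 < ∑ i ∈ s, w i) (hsum : ∑ i ∈ s, w i * (F (p i) - A) ≤ R) :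
    F ((∑ i ∈ s, w i)⁻¹ • ∑ i ∈ s, w i • p i) ≤ A + R / ∑ i ∈ s, w i := by
  refine (hF.map_centerMass_le hw hpos fun _ _ => Set.mem_univ _).trans ?_
  simp only [mul_sub, Finset.sum_sub_distrib, ← Finset.sum_mul] at hsum
  simp only [Finset.centerMass, Function.comp, smul_eq_mul]
  rw [inv_mul_le_iff₀ hpos, mul_add, mul_div_cancel₀ _ hpos.ne']
  linarith

variable [CompleteSpace E]

theorem HasGradientAt.hasDerivAt_add_smul {f : E → ℝ} {g w v : E} {t : ℝ}
    (hf : HasGradientAt f g (w + t • v)) :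
    HasDerivAt (fun s : ℝ => f (w + s • v)) ⟪g, v⟫ t := by
  have hline : HasDerivAt (fun s : ℝ => w + s • v) v t := by
    simpa using ((hasDerivAt_id t).smul_const v).const_add w
  simpa using! hf.hasFDerivAt.comp_hasDerivAt t hline

theorem StrongConvexOn.add_inner_add_le {f : E → ℝ} {g w : E} {m : ℝ}
    (hf : StrongConvexOn Set.univ m f) (hg : HasGradientAt f g w) (u : E) :
    f w + ⟪g, u - w⟫ + m / 2 * ‖u - w‖ ^ 2 ≤ f u := by
  have hderiv : HasDerivAt (fun s : ℝ => f (w + s • (u - w))) ⟪g, u - w⟫ 0 :=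
    HasGradientAt.hasDerivAt_add_smul (by simpa using hg)
  have hslope := hderiv.tendsto_slope_zero_right
  have hlim : Tendsto (fun t : ℝ => f u - f w - (1 - t) * (m / 2 * ‖u - w‖ ^ 2))
      (nhdsWithin 0 (Set.Ioi 0)) (nhds (f u - f w - (1 - 0) * (m / 2 * ‖u - w‖ ^ 2))) :=
    ((by fun_prop : Continuous
      fun t : ℝ => f u - f w - (1 - t) * (m / 2 * ‖u - w‖ ^ 2)).tendsto 0).mono_left
      nhdsWithin_le_nhds
  have hle : ⟪g, u - w⟫ ≤ f u - f w - (1 - 0) * (m / 2 * ‖u - w‖ ^ 2) := by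
    refine le_of_tendsto_of_tendsto hslope hlim ?_
    filter_upwards [Ioo_mem_nhdsGT (zero_lt_one (α := ℝ))] with t ht
    have hsc := hf.2 (Set.mem_univ u) (Set.mem_univ w) ht.1.le (sub_nonneg.2 ht.2.le)
      (add_sub_cancel t 1)
    have hpt : w + t • (u - w) = t • u + (1 - t) • w := by module
    simp only [smul_eq_mul] at hsc
    simp only [zero_add, zero_smul, add_zero, smul_eq_mul, hpt]
    rw [inv_mul_le_iff₀ ht.1]
    linarith
  linarith

/-- The descent lemma for functions with Lipschitz gradient. -/
theorem le_add_inner_add_of_lipschitz_gradient {f : E → ℝ} {f' : E → E} {L : ℝ}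
    (hf : ∀ x, HasGradientAt f (f' x) x) (hlip : ∀ x y, ‖f' x - f' y‖ ≤ L * ‖x - y‖) (w u : E) :
    f u ≤ f w + ⟪f' w, u - w⟫ + L / 2 * ‖u - w‖ ^ 2 := by
  set v := u - w with hv
  have hderiv : ∀ t : ℝ, HasDerivAt
      (fun s : ℝ => f (w + s • v) - (s * ⟪f' w, v⟫ + L / 2 * ‖v‖ ^ 2 * s ^ 2))
      (⟪f' (w + t • v), v⟫ - (⟪f' w, v⟫ + L / 2 * ‖v‖ ^ 2 * (2 * t))) t := by
    intro t
    refine (HasGradientAt.hasDerivAt_add_smul (hf _)).sub (HasDerivAt.add ?_ ?_)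
    · simpa using (hasDerivAt_id t).mul_const ⟪f' w, v⟫
    · simpa using ((hasDerivAt_id t).pow 2).const_mul (L / 2 * ‖v‖ ^ 2)
  have hanti := antitoneOn_of_deriv_nonpos (convex_Icc (0 : ℝ) 1)
    (fun t _ => (hderiv t).continuousAt.continuousWithinAt)
    (fun t _ => (hderiv t).differentiableAt.differentiableWithinAt) (by
      intro t ht
      rw [interior_Icc] at ht
      rw [(hderiv t).deriv]
      have hinner : ⟪f' (w + t • v) - f' w, v⟫ ≤ L * ‖w + t • v - w‖ * ‖v‖ :=
        (real_inner_le_norm _ _).trans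
          (mul_le_mul_of_nonneg_right (hlip _ _) (norm_nonneg _))
      rw [inner_sub_left, add_sub_cancel_left, norm_smul, Real.norm_eq_abs,
        abs_of_pos ht.1] at hinner
      linarith)
  have hends := hanti (Set.left_mem_Icc.2 zero_le_one) (Set.right_mem_Icc.2 zero_le_one)
    zero_le_one
  have hu : w + v = u := by rw [hv]; abel
  simp only [one_smul, hu, zero_smul, add_zero] at hends
  linarith

/-- One step of the proximal gradient method on the regularized objective
`(h + ωh) + η • (f + ωf)`. -/
theorem proxGrad_step {f h ωf ωh : E → ℝ} {f' h' : E → E} {Lf Lh μ η γ : ℝ} {w p : E}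
    (hf : ∀ x, HasGradientAt f (f' x) x) (hf_lip : ∀ x y, ‖f' x - f' y‖ ≤ Lf * ‖x - y‖)
    (hf_sc : StrongConvexOn Set.univ μ f)
    (hh : ∀ x, HasGradientAt h (h' x) x) (hh_lip : ∀ x y, ‖h' x - h' y‖ ≤ Lh * ‖x - y‖)
    (hh_conv : ConvexOn ℝ Set.univ h)
    (hωf : ConvexOn ℝ Set.univ ωf) (hωh : ConvexOn ℝ Set.univ ωh)
    (hη : 0 ≤ η) (hγ : 0 < γ) (hγL : γ * (Lh + η * Lf) ≤ 1)
    (hp : ∀ u, ωh p + η * ωf p + 1 / (2 * γ) * ‖p - (w - γ • (h' w + η • f' w))‖ ^ 2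
      ≤ ωh u + η * ωf u + 1 / (2 * γ) * ‖u - (w - γ • (h' w + η • f' w))‖ ^ 2) (y : E) :
    2 * γ * ((h p + ωh p - (h y + ωh y)) + η * (f p + ωf p - (f y + ωf y)))
      ≤ (1 - η * γ * μ) * ‖w - y‖ ^ 2 - ‖p - y‖ ^ 2 := by
  have hprox := (hωh.add (hωf.smul hη)).prox_three_point (p := p) hp y
  have hexp : ∀ u, ‖u - (w - γ • (h' w + η • f' w))‖ ^ 2 = ‖u - w‖ ^ 2
      + 2 * γ * (⟪h' w, u - w⟫ + η * ⟪f' w, u - w⟫) + ‖γ • (h' w + η • f' w)‖ ^ 2 := by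
    intro u
    have hsplit : u - (w - γ • (h' w + η • f' w)) = (u - w) + γ • (h' w + η • f' w) := by abel
    rw [hsplit, norm_add_sq_real, real_inner_comm, inner_smul_left, inner_add_left,
      inner_smul_left]
    simp only [conj_trivial]
    ring
  have hprox' := mul_le_mul_of_nonneg_left hprox (by positivity : 0 ≤ 2 * γ)
  simp only [Pi.add_apply, smul_eq_mul, hexp] at hprox'
  field_simp at hprox'
  have hfu := hf_sc.add_inner_add_le (hf w) y
  have hhu := (strongConvexOn_zero.2 hh_conv).add_inner_add_le (hh w) y
  have hfp := le_add_inner_add_of_lipschitz_gradient hf hf_lip w p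
  have hhp := le_add_inner_add_of_lipschitz_gradient hh hh_lip w p
  have hL := mul_le_mul_of_nonneg_right hγL (sq_nonneg ‖p - w‖)
  have hfu' := mul_le_mul_of_nonneg_left hfu (by positivity : 0 ≤ 2 * γ * η)
  have hfp' := mul_le_mul_of_nonneg_left hfp (by positivity : 0 ≤ 2 * γ * η)
  have hhu' := mul_le_mul_of_nonneg_left hhu (by positivity : 0 ≤ 2 * γ)
  have hhp' := mul_le_mul_of_nonneg_left hhp (by positivity : 0 ≤ 2 * γ)
  rw [norm_sub_rev w y, norm_sub_rev p y]
  linarith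


end Convexity

theorem sum_mul_sub_succ_le {η a : ℕ → ℝ} (hη : Antitone η) (hηpos : ∀ k, 0 ≤ η k)
    (ha : ∀ k, 0 ≤ a k) (K : ℕ) :
    ∑ k ∈ Finset.range K, η k * (a k - a (k + 1)) ≤ η 0 * a 0 := by
  suffices hK : ∑ k ∈ Finset.range K, η k * (a k - a (k + 1)) ≤ η 0 * a 0 - η K * a K from
    hK.trans (sub_le_self _ (mul_nonneg (hηpos K) (ha K)))
  induction K with
  | zero => simp
  | succ K ih =>
    rw [Finset.sum_range_succ]
    linarith [mul_le_mul_of_nonneg_right (hη K.le_succ) (ha (K + 1))]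

theorem stmt_11
    {n : ℕ}
    (f h ωf ωh : EuclideanSpace ℝ (Fin n) → ℝ)
    (f' h' : EuclideanSpace ℝ (Fin n) → EuclideanSpace ℝ (Fin n))
    (Lf Lh μf : ℝ)
    (hμf_pos : 0 < μf) (hμf_le : μf ≤ Lf) (hLh_pos : 0 < Lh)
    (hf_grad : ∀ x, HasGradientAt f (f' x) x)
    (hf_lip : ∀ x y, ‖f' x - f' y‖ ≤ Lf * ‖x - y‖)
    (hf_sc : StrongConvexOn Set.univ μf f)
    (hh_grad : ∀ x, HasGradientAt h (h' x) x)
    (hh_lip : ∀ x y, ‖h' x - h' y‖ ≤ Lh * ‖x - y‖)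
    (hh_conv : ConvexOn ℝ Set.univ h)
    (hωf_conv : ConvexOn ℝ Set.univ ωf)
    (hωh_conv : ConvexOn ℝ Set.univ ωh)
    (fbar hbar : EuclideanSpace ℝ (Fin n) → ℝ)
    (hfbar : ∀ x, fbar x = f x + ωf x)
    (hhbar : ∀ x, hbar x = h x + ωh x)
    (X : Set (EuclideanSpace ℝ (Fin n)))
    (hX : X = {z | ∀ y, hbar z ≤ hbar y})
    (hXne : X.Nonempty)
    (hstar : ℝ)
    (hhstar : IsGLB (Set.range hbar) hstar)
    (xstar : EuclideanSpace ℝ (Fin n))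
    (hxstar_mem : xstar ∈ X)
    (hxstar_min : ∀ y ∈ X, fbar xstar ≤ fbar y)
    (x : ℕ → EuclideanSpace ℝ (Fin n))
    (η : ℕ → ℝ) (γ : ℝ)
    (hη_pos : ∀ k, 0 < η k)
    (hη_mono : ∀ k, η (k+1) ≤ η k)
    (hγ_pos : 0 < γ)
    (hγ_le : γ ≤ 1 / (Lh + η 0 * Lf))
    (hx_iter : ∀ k u,
      ωh (x (k+1)) + η k * ωf (x (k+1))
        + 1 / (2*γ) * ‖x (k+1) - (x k - γ • (h' (x k) + η k • f' (x k)))‖ ^ 2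
      ≤ ωh u + η k * ωf u
        + 1 / (2*γ) * ‖u - (x k - γ • (h' (x k) + η k • f' (x k)))‖ ^ 2)
    (θ : ℕ → ℝ)
    (hθ : ∀ k, θ k = 1 / ∏ t ∈ Finset.range (k+1), (1 - η t * γ * μf))
    (xbar : ℕ → EuclideanSpace ℝ (Fin n))
    (hxbar : ∀ K, xbar K = (∑ j ∈ Finset.range K, θ j * η j)⁻¹ •
        ∑ k ∈ Finset.range K, (θ k * η k) • x (k+1))
    (Cf : ℝ)
    (hCf : IsGLB (Set.range fbar) Cf)
    (hsup : ∃ M : ℝ, ∀ K : ℕ, 1 ≤ K →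
        (∑ j ∈ Finset.range K, θ j * η j) / θ (K - 1) ≤ M)
    (hratio : Filter.Tendsto (fun k : ℕ =>
        (∑ j ∈ Finset.range (k+1), η j ^ 2 * θ j)
          / (∑ j ∈ Finset.range (k+1), η j * θ j)) Filter.atTop (nhds 0))
    (hdiv : Filter.Tendsto (fun K : ℕ => ∑ j ∈ Finset.range K, η j * θ j)
        Filter.atTop Filter.atTop) :
    Filter.Tendsto xbar Filter.atTop (nhds xstar) := by
  have hmono : Antitone η := antitone_nat_of_succ_le hη_mono
  have hLf : 0 < Lf := hμf_pos.trans_le hμf_le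
  have hγL : γ * (Lh + η 0 * Lf) ≤ 1 :=
    (le_div_iff₀ (by have := hη_pos 0; positivity)).1 hγ_le
  have hstep : ∀ k, γ * (Lh + η k * Lf) ≤ 1 := fun k =>
    (mul_le_mul_of_nonneg_left (add_le_add_right
      (mul_le_mul_of_nonneg_right (hmono k.zero_le) hLf.le) Lh) hγ_pos.le).trans hγL
  have hfactor : ∀ k, 0 < 1 - η k * γ * μf := by
    intro k
    have hle := mul_le_mul_of_nonneg_left hμf_le (mul_pos (hη_pos k) hγ_pos).le
    have := mul_pos hγ_pos hLh_pos
    linarith [hstep k]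
  set P : ℕ → ℝ := fun k => ∏ t ∈ Finset.range k, (1 - η t * γ * μf)
  have hPpos : ∀ k, 0 < P k := fun k => Finset.prod_pos fun t _ => hfactor t
  have hPsucc : ∀ k, P (k + 1) = P k * (1 - η k * γ * μf) := fun k =>
    Finset.prod_range_succ _ k
  have hθP : ∀ k, θ k = 1 / P (k + 1) := hθ
  have hθpos : ∀ k, 0 < θ k := fun k => by rw [hθP]; exact one_div_pos.2 (hPpos _)
  set a : ℕ → ℝ := fun k => ‖x k - xstar‖ ^ 2 / P k with ha
  have ha0 : ∀ k, 0 ≤ a k := fun k => div_nonneg (sq_nonneg _) (hPpos k).le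
  subst hX
  have hHnonneg : ∀ k, 0 ≤ hbar (x (k + 1)) - hbar xstar := fun k => sub_nonneg.2 (hxstar_mem _)
  have hrec : ∀ k, 2 * γ * (θ k * (hbar (x (k + 1)) - hbar xstar)
      + θ k * η k * (fbar (x (k + 1)) - fbar xstar)) ≤ a k - a (k + 1) := by
    intro k
    have hprox := mul_le_mul_of_nonneg_left
      (proxGrad_step hf_grad hf_lip hf_sc hh_grad hh_lip hh_conv hωf_conv hωh_conv
        (hη_pos k).le hγ_pos (hstep k) (hx_iter k) xstar) (hθpos k).le
    simp only [← hfbar, ← hhbar] at hprox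
    have hak : a k = θ k * ((1 - η k * γ * μf) * ‖x k - xstar‖ ^ 2) := by
      have := (hPpos k).ne'
      have := (hfactor k).ne'
      simp only [ha, hθP, hPsucc]
      field_simp
    have hak' : a (k + 1) = θ k * ‖x (k + 1) - xstar‖ ^ 2 := by
      simp only [ha, hθP]
      ring
    rw [hak, hak']
    linarith
  have hupper : ∀ K, ∑ k ∈ Finset.range K, θ k * η k * (fbar (x (k + 1)) - fbar xstar)
      ≤ a 0 / (2 * γ) := by
    intro K
    rw [le_div_iff₀ (by positivity), Finset.sum_mul]
    refine (Finset.sum_le_sum fun k _ => ?_).trans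
      ((Finset.sum_range_sub' a K).trans_le (sub_le_self _ (ha0 K)))
    have := mul_nonneg (by positivity : 0 ≤ 2 * γ) (mul_nonneg (hθpos k).le (hHnonneg k))
    linarith [hrec k]
  have hlower : ∀ K, ∑ k ∈ Finset.range K, θ k * η k * (hbar (x (k + 1)) - hbar xstar)
      ≤ η 0 * a 0 / (2 * γ) + (fbar xstar - Cf) * ∑ k ∈ Finset.range K, η k ^ 2 * θ k := by
    intro K
    rw [← sub_le_iff_le_add, le_div_iff₀ (by positivity), Finset.mul_sum,
      ← Finset.sum_sub_distrib, Finset.sum_mul]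
    refine (Finset.sum_le_sum fun k _ => ?_).trans
      (sum_mul_sub_succ_le hmono (fun k => (hη_pos k).le) ha0 K)
    have hbelow : Cf ≤ fbar (x (k + 1)) := hCf.1 ⟨_, rfl⟩
    have hterm := mul_le_mul_of_nonneg_left hbelow
      (mul_pos (mul_pos two_pos hγ_pos) (mul_pos (pow_pos (hη_pos k) 2) (hθpos k))).le
    have hscaled := mul_le_mul_of_nonneg_left (hrec k) (hη_pos k).le
    linarith
  have hswap : ∀ K, ∑ j ∈ Finset.range K, η j * θ j = ∑ j ∈ Finset.range K, θ j * η j :=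
    fun K => Finset.sum_congr rfl fun j _ => mul_comm _ _
  simp only [hswap] at hratio hdiv
  have hratio' := (tendsto_add_atTop_iff_nat (f := fun K =>
    (∑ j ∈ Finset.range K, η j ^ 2 * θ j) / ∑ j ∈ Finset.range K, θ j * η j) 1).1 hratio
  have hgap := (hdiv.const_div_atTop (η 0 * a 0 / (2 * γ))).add
    (hratio'.const_mul (fbar xstar - Cf))
  rw [mul_zero, add_zero] at hgap
  have hfbar_eq : fbar = f + ωf := funext hfbar
  have hbar_eq : hbar = h + ωh := funext hhbar
  have hF : StrongConvexOn Set.univ μf fbar := by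
    simpa [hfbar_eq, StrongConvexOn] using! hf_sc.add (uniformConvexOn_zero.2 hωf_conv)
  have hH : ConvexOn ℝ Set.univ hbar := hbar_eq ▸ hh_conv.add hωh_conv
  have hFconv : ConvexOn ℝ Set.univ fbar := hF.convexOn fun r => by
    simp only [Pi.zero_apply]; positivity
  refine tendsto_of_asymptotically_bilevel_optimal hF hμf_pos hFconv.locallyLipschitz.continuous
    hH hH.locallyLipschitz.continuous (fun z hz => hxstar_min z fun y => hz.trans (hxstar_mem y))
    (fun z => hCf.1 ⟨z, rfl⟩) (hdiv.const_div_atTop (a 0 / (2 * γ)))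
    hgap ?_ ?_
  · filter_upwards [hdiv.eventually_gt_atTop 0] with K hK
    rw [hxbar]
    exact hFconv.map_weighted_average_le (fun k _ => (mul_pos (hθpos k) (hη_pos k)).le) hK
      (hupper K)
  · filter_upwards [hdiv.eventually_gt_atTop 0] with K hK
    have havg := hH.map_weighted_average_le (p := fun k => x (k + 1))
      (fun k _ => (mul_pos (hθpos k) (hη_pos k)).le) hK (hlower K)
    rwa [add_div, mul_div_assoc (fbar xstar - Cf), ← hxbar] at havg
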